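/- arXiv:2407.03289 — 13 statements merged into one kernel-verified Lean document; each statement's English description precedes it below -/
import Mathlib

section
/- For all ε ∈ (0,1) and δ ∈ (0,1), σ_{ε,δ}² ≤ 8·ln(1.25/δ)/ε². -/
/-- The standard Gaussian cumulative distribution function. -/
noncomputable def Phi (x : ℝ) : ℝ :=
  ∫ t in Set.Iic x, (Real.sqrt (2 * Real.pi))⁻¹ * Real.exp (-t ^ 2 / 2)

/-- `σ_{ε,δ}`: the least noise level making the Gaussian mechanism
(sensitivity 2) `(ε,δ)`-DP. -/
noncomputable def sigmaEpsDelta (ε δ : ℝ) : ℝ :=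
  sInf {σ : ℝ | 0 < σ ∧
    Phi (1 / σ - ε * σ / 2) - Real.exp ε * Phi (-(1 / σ) - ε * σ / 2) ≤ δ}

/-- The standard Gaussian density. -/
noncomputable def gaussDensity (t : ℝ) : ℝ :=
  (Real.sqrt (2 * Real.pi))⁻¹ * Real.exp (-t ^ 2 / 2)

lemma gaussDensity_nonneg (t : ℝ) : 0 ≤ gaussDensity t := by
  unfold gaussDensity; positivity

lemma gaussDensity_le_one (t : ℝ) : gaussDensity t ≤ 1 := by
  unfold gaussDensity
  have h1 : (Real.sqrt (2 * Real.pi))⁻¹ ≤ 1 := by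
    apply inv_le_one_of_one_le₀
    rw [Real.one_le_sqrt]
    linarith [Real.pi_gt_three]
  have h2 : Real.exp (-t ^ 2 / 2) ≤ 1 := by
    rw [Real.exp_le_one_iff]
    linarith [sq_nonneg t]
  exact mul_le_one₀ h1 (Real.exp_pos _).le h2

lemma integrable_gaussDensity : MeasureTheory.Integrable gaussDensity := by
  have h := (integrable_exp_neg_mul_sq (b := 1 / 2) (by norm_num)).const_mul
    (Real.sqrt (2 * Real.pi))⁻¹
  refine h.congr (Filter.Eventually.of_forall fun t => ?_)
  simp only [gaussDensity]
  ring_nf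

lemma Phi_eq (x : ℝ) : Phi x = ∫ t in Set.Iic x, gaussDensity t := rfl

lemma Phi_nonneg (x : ℝ) : 0 ≤ Phi x :=
  MeasureTheory.integral_nonneg gaussDensity_nonneg

lemma Phi_zero : Phi 0 = 1 / 2 := by
  have h : ∫ t in Set.Iic (0 : ℝ), gaussDensity (-t) = ∫ t in Set.Ioi (0 : ℝ), gaussDensity t := by
    simp
  have heven : ∀ t, gaussDensity (-t) = gaussDensity t := fun t => by simp [gaussDensity]
  simp only [heven] at h
  rw [Phi_eq, h]
  simp only [gaussDensity]
  rw [MeasureTheory.integral_const_mul]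
  have h2 := integral_gaussian_Ioi (1 / 2)
  have h3 : ∀ t : ℝ, -t ^ 2 / 2 = -(1 / 2) * t ^ 2 := fun t => by ring
  simp only [h3, h2]
  rw [show Real.pi / (1 / 2) = 2 * Real.pi by ring]
  field_simp

lemma Phi_eq_shift (x : ℝ) : Phi x = ∫ t in Set.Iic (0 : ℝ), gaussDensity (t + x) := by
  rw [Phi_eq, ← MeasureTheory.integral_indicator measurableSet_Iic,
    ← MeasureTheory.integral_indicator measurableSet_Iic,
    ← MeasureTheory.integral_add_right_eq_self _ x]
  congr 1
  ext t
  simp [Set.indicator]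

/-- The Chernoff-type bound on the lower Gaussian tail, with the sharp constant `1 / 2`. -/
lemma Phi_le_half_exp {x : ℝ} (hx : x ≤ 0) : Phi x ≤ 1 / 2 * Real.exp (-x ^ 2 / 2) := by
  rw [← Phi_zero, Phi_eq_shift, Phi_eq, ← MeasureTheory.integral_mul_const]
  refine MeasureTheory.setIntegral_mono_on (integrable_gaussDensity.comp_add_right x).integrableOn
    (integrable_gaussDensity.mul_const _).integrableOn measurableSet_Iic fun t ht => ?_
  have ht : t ≤ 0 := ht
  simp only [gaussDensity]
  rw [mul_assoc, ← Real.exp_add]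
  gcongr
  nlinarith [mul_nonneg_of_nonpos_of_nonpos ht hx]

lemma Phi_le_half_add {x : ℝ} (hx : 0 ≤ x) : Phi x ≤ 1 / 2 + x := by
  have h := intervalIntegral.integral_Iic_sub_Iic (a := 0) (b := x)
    integrable_gaussDensity.integrableOn integrable_gaussDensity.integrableOn
  have h2 : ∫ t in (0 : ℝ)..x, gaussDensity t ≤ ∫ _ in (0 : ℝ)..x, (1 : ℝ) :=
    intervalIntegral.integral_mono_on hx integrable_gaussDensity.intervalIntegrable
      intervalIntegrable_const fun t _ => gaussDensity_le_one t
  rw [← Phi_eq, ← Phi_eq, Phi_zero] at h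
  simp at h2
  linarith

lemma Phi_sub_le {a b : ℝ} (ha : 0 < a) (ha2 : 2 / 5 ≤ a ^ 2) (hab : a * b ≤ 1 / 2) :
    Phi (b - a) ≤ 5 / 4 * Real.exp (-a ^ 2 / 2) := by
  rcases le_total b a with h | h
  · refine (Phi_le_half_exp (sub_nonpos.2 h)).trans ?_
    have h1 : Real.exp (-(b - a) ^ 2 / 2) ≤ Real.exp (1 / 2) * Real.exp (-a ^ 2 / 2) := by
      rw [← Real.exp_add]
      gcongr
      nlinarith [sq_nonneg b]
    have h2 : Real.exp (1 / 2) ≤ 5 / 2 := by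
      have h3 := Real.exp_one_lt_d9
      have h4 : Real.exp (1 / 2) ≤ Real.exp 1 := Real.exp_le_exp.2 (by norm_num)
      have h5 : Real.exp (1 / 2) * Real.exp (1 / 2) = Real.exp 1 := by
        rw [← Real.exp_add]; norm_num
      nlinarith
    nlinarith [Real.exp_pos (-a ^ 2 / 2)]
  · refine (Phi_le_half_add (sub_nonneg.2 h)).trans ?_
    have h1 := Real.add_one_le_exp (-a ^ 2 / 2)
    have h2 : 3 / 5 ≤ a := by nlinarith
    have h3 : a ^ 2 ≤ 1 / 2 := by nlinarith
    have h4 : b ≤ 5 / 6 := by nlinarith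
    linarith

/-- for `ε, δ ∈ (0,1)`, `σ_{ε,δ}² ≤ 8 ln(1.25/δ)/ε²`. -/
theorem stmt_2 (ε δ : ℝ) (hε0 : 0 < ε) (hε1 : ε < 1) (hδ0 : 0 < δ) (hδ1 : δ < 1) :
    (sigmaEpsDelta ε δ) ^ 2 ≤ 8 * Real.log (1.25 / δ) / ε ^ 2 := by
  set L := Real.log (1.25 / δ) with hL
  have hpos : 0 < 1.25 / δ := by positivity
  have hL1 : 1 / 5 ≤ L := by
    have h1 := Real.one_sub_inv_le_log_of_pos hpos
    have h2 : (1.25 / δ)⁻¹ ≤ 4 / 5 := by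
      rw [inv_div, div_le_iff₀ (by norm_num)]
      linarith
    linarith
  set a := Real.sqrt (2 * L)
  have ha : 0 < a := Real.sqrt_pos.2 (by linarith)
  have ha2 : a ^ 2 = 2 * L := Real.sq_sqrt (by linarith)
  have hδ : 5 / 4 * Real.exp (-a ^ 2 / 2) = δ := by
    rw [show -a ^ 2 / 2 = -L by rw [ha2]; ring, Real.exp_neg, hL, Real.exp_log hpos]
    field_simp
    norm_num
  have hle : sigmaEpsDelta ε δ ≤ 2 * a / ε := by
    refine csInf_le ⟨0, fun s hs => hs.1.le⟩ ⟨by positivity, ?_⟩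
    have h := Phi_sub_le (b := 1 / (2 * a / ε)) ha (by linarith) (by field_simp; linarith)
    rw [show ε * (2 * a / ε) / 2 = a by field_simp]
    have h2 := mul_nonneg (Real.exp_pos ε).le (Phi_nonneg (-(1 / (2 * a / ε)) - a))
    linarith
  have h0 : 0 ≤ sigmaEpsDelta ε δ := Real.sInf_nonneg fun s hs => hs.1.le
  calc (sigmaEpsDelta ε δ) ^ 2 ≤ (2 * a / ε) ^ 2 := by gcongr
    _ = 8 * L / ε ^ 2 := by rw [div_pow, mul_pow, ha2]; ring
end

section
/- For all ε ≥ 1 and δ ∈ (0,1): if δ ∈ (0, 0.05] then σ_{ε,δ}² ≤ 2·(1 + 2·√(ln(1/(2δ))))²/ε, and if δ ∈ (0.05, 1) then σ_{ε,δ}² ≤ 2·(1 + 2·√(ln 10))²/ε. -/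
open MeasureTheory ProbabilityTheory in
lemma Phi_eq_gaussianReal (x : ℝ) : Phi x = (gaussianReal 0 1).real (Set.Iic x) := by
  rw [measureReal_def, gaussianReal_apply_eq_integral 0 one_ne_zero, ENNReal.toReal_ofReal
    (integral_nonneg fun t => gaussianPDFReal_nonneg 0 1 t)]
  simp [Phi, gaussianPDFReal]

open MeasureTheory ProbabilityTheory in
/-- The Chernoff bound for the lower Gaussian tail. -/
lemma Phi_neg_le {x : ℝ} (hx : 0 ≤ x) : Phi (-x) ≤ Real.exp (-x ^ 2 / 2) := by
  rw [Phi_eq_gaussianReal]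
  have h := measure_le_le_exp_mul_mgf (μ := gaussianReal 0 1) (X := id) (-x) (t := -x)
    (by linarith) (integrable_exp_mul_gaussianReal (-x))
  rw [mgf_id_gaussianReal] at h
  refine h.trans (le_of_eq ?_)
  simp only [← Real.exp_add, NNReal.coe_one]
  ring_nf

lemma sigmaEpsDelta_sq_le {ε δ σ : ℝ} (hσ : 0 < σ)
    (h : Phi (1 / σ - ε * σ / 2) - Real.exp ε * Phi (-(1 / σ) - ε * σ / 2) ≤ δ) :
    sigmaEpsDelta ε δ ^ 2 ≤ σ ^ 2 :=
  pow_le_pow_left₀ (Real.sInf_nonneg fun _ hy => hy.1.le)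
    (csInf_le (⟨0, fun _ hy => hy.1.le⟩ : BddBelow _) (Set.mem_ofPred.2 ⟨hσ, h⟩)) 2

lemma sigmaEpsDelta_sq_le_of_exp_le {ε δ s : ℝ} (hε : 1 ≤ ε) (hs : 1 ≤ s)
    (hδ : Real.exp (-s ^ 2) / 2 ≤ δ) :
    sigmaEpsDelta ε δ ^ 2 ≤ 2 * (1 + 2 * s) ^ 2 / ε := by
  have hε0 : 0 < ε := by linarith
  set c := 1 + 2 * s with hc
  have hc0 : 0 < c := by positivity
  have hσ2 : Real.sqrt (2 * c ^ 2 / ε) ^ 2 = 2 * c ^ 2 / ε := Real.sq_sqrt (by positivity)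
  have hσ : 0 < Real.sqrt (2 * c ^ 2 / ε) := Real.sqrt_pos.2 (by positivity)
  rw [← hσ2]
  set σ := Real.sqrt (2 * c ^ 2 / ε)
  apply sigmaEpsDelta_sq_le hσ
  have hεσ : ε * σ ^ 2 = 2 * c ^ 2 := by rw [hσ2]; field_simp
  have hx : 0 ≤ ε * σ / 2 - 1 / σ := by
    have : ε * σ / 2 - 1 / σ = (c ^ 2 - 1) / σ := by
      field_simp
      linarith
    rw [this]
    exact div_nonneg (by nlinarith) hσ.le
  have hsq : (c ^ 2 - 2) / 2 ≤ (ε * σ / 2 - 1 / σ) ^ 2 := by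
    have h1 : (ε * σ / 2 - 1 / σ) ^ 2 = ε * (ε * σ ^ 2) / 4 - ε + (1 / σ) ^ 2 := by
      field_simp
      ring
    rw [h1, hεσ]
    nlinarith [sq_nonneg (1 / σ), mul_nonneg (sub_nonneg.2 hε) (show 0 ≤ c ^ 2 - 2 by nlinarith)]
  have htail := Phi_neg_le hx
  rw [neg_sub] at htail
  have hexp : Real.exp (-(ε * σ / 2 - 1 / σ) ^ 2 / 2) ≤ Real.exp (-s ^ 2) / 2 := by
    rw [← Real.exp_log (two_pos : (0 : ℝ) < 2), ← Real.exp_sub, Real.exp_log two_pos]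
    apply Real.exp_le_exp.2
    have := Real.log_two_lt_d9
    have : c ^ 2 = 1 + 4 * s + 4 * s ^ 2 := by rw [hc]; ring
    linarith
  have := mul_nonneg (Real.exp_pos ε).le (Phi_nonneg (-(1 / σ) - ε * σ / 2))
  linarith

/-- bounds on `σ_{ε,δ}²` for `ε ≥ 1` and `δ ∈ (0,1)`. -/
theorem stmt_3 (ε δ : ℝ) (hε : 1 ≤ ε) (hδ0 : 0 < δ) (hδ1 : δ < 1) :
    (δ ≤ 0.05 →
      (sigmaEpsDelta ε δ) ^ 2 ≤ 2 * (1 + 2 * Real.sqrt (Real.log (1 / (2 * δ)))) ^ 2 / ε)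
    ∧ (0.05 < δ →
      (sigmaEpsDelta ε δ) ^ 2 ≤ 2 * (1 + 2 * Real.sqrt (Real.log 10)) ^ 2 / ε) := by
  have hlog : 1 ≤ Real.log 10 := by
    rw [Real.le_log_iff_exp_le (by norm_num)]
    linarith [Real.exp_one_lt_d9]
  constructor
  · intro h
    have hlog' : 1 ≤ Real.log (1 / (2 * δ)) := by
      refine hlog.trans (Real.log_le_log (by norm_num) ?_)
      rw [le_div_iff₀ (by positivity)]
      norm_num at h
      linarith
    apply sigmaEpsDelta_sq_le_of_exp_le hε (Real.one_le_sqrt.2 hlog')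
    rw [Real.sq_sqrt (by linarith), Real.exp_neg, Real.exp_log (by positivity)]
    apply le_of_eq
    field_simp
  · intro h
    apply sigmaEpsDelta_sq_le_of_exp_le hε (Real.one_le_sqrt.2 hlog)
    rw [Real.sq_sqrt (by linarith), Real.exp_neg, Real.exp_log (by norm_num)]
    norm_num at h ⊢
    linarith
end

section
/- For every fixed ε > 0, the function σ̂ ↦ Φ(1/σ̂ − ε·σ̂/2) − e^ε·Φ(−1/σ̂ − ε·σ̂/2) is strictly decreasing on (0, ∞). -/
/-- The derivative of the Gaussian cumulative distribution function is the Gaussian density. -/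
theorem hasDerivAt_Phi (x : ℝ) :
    HasDerivAt Phi ((Real.sqrt (2 * Real.pi))⁻¹ * Real.exp (-x ^ 2 / 2)) x := by
  have hint : MeasureTheory.Integrable
      (fun t : ℝ => (Real.sqrt (2 * Real.pi))⁻¹ * Real.exp (-t ^ 2 / 2)) := by
    refine MeasureTheory.Integrable.const_mul ?_ _
    refine (integrable_exp_neg_mul_sq (b := 1 / 2) (by norm_num)).congr
      (Filter.Eventually.of_forall fun t => ?_)
    ring_nf
  have hcont : Continuous
      (fun t : ℝ => (Real.sqrt (2 * Real.pi))⁻¹ * Real.exp (-t ^ 2 / 2)) := by fun_prop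
  have hPhi : Phi = fun y => (∫ t in (0 : ℝ)..y,
      (Real.sqrt (2 * Real.pi))⁻¹ * Real.exp (-t ^ 2 / 2)) + Phi 0 := by
    funext y
    rw [← intervalIntegral.integral_Iic_sub_Iic hint.integrableOn hint.integrableOn]
    simp only [Phi, sub_add_cancel]
  rw [hPhi]
  exact (hcont.integral_hasStrictDerivAt 0 x).hasDerivAt.add_const _

/-- for fixed `ε > 0`, the map
`σ̂ ↦ Φ(1/σ̂ − εσ̂/2) − e^ε Φ(−1/σ̂ − εσ̂/2)` is strictly decreasing on `(0,∞)`. -/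
theorem stmt_4 (ε : ℝ) (hε : 0 < ε) :
    StrictAntiOn
      (fun σ : ℝ => Phi (1 / σ - ε * σ / 2) - Real.exp ε * Phi (-(1 / σ) - ε * σ / 2))
      (Set.Ioi 0) := by
  have hderiv : ∀ σ ∈ Set.Ioi (0 : ℝ), HasDerivAt
      (fun σ : ℝ => Phi (1 / σ - ε * σ / 2) - Real.exp ε * Phi (-(1 / σ) - ε * σ / 2))
      ((Real.sqrt (2 * Real.pi))⁻¹ * Real.exp (-(1 / σ - ε * σ / 2) ^ 2 / 2) *
        (-(2 / σ ^ 2))) σ := by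
    intro σ hσ
    have hσ0 : σ ≠ 0 := (Set.mem_Ioi.mp hσ).ne'
    have hinv : HasDerivAt (fun s : ℝ => 1 / s) (-(σ ^ 2)⁻¹) σ := by
      simpa only [one_div] using hasDerivAt_inv hσ0
    have hlin : HasDerivAt (fun s : ℝ => ε * s / 2) (ε / 2) σ := by
      simpa using ((hasDerivAt_id σ).const_mul ε).div_const 2
    have hupper := (hasDerivAt_Phi (1 / σ - ε * σ / 2)).comp σ (hinv.sub hlin)
    have hlower := (hasDerivAt_Phi (-(1 / σ) - ε * σ / 2)).comp σ (hinv.neg.sub hlin)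
    have hexp : Real.exp (-(1 / σ - ε * σ / 2) ^ 2 / 2) =
        Real.exp ε * Real.exp (-(-(1 / σ) - ε * σ / 2) ^ 2 / 2) := by
      rw [← Real.exp_add]
      congr 1
      field_simp
      ring
    refine (hupper.sub (hlower.const_mul (Real.exp ε))).congr_deriv ?_
    rw [hexp]
    ring
  refine strictAntiOn_of_deriv_neg (convex_Ioi 0)
    (fun σ hσ => (hderiv σ hσ).continuousAt.continuousWithinAt) fun σ hσ => ?_
  rw [interior_Ioi] at hσ
  have hσpos : 0 < σ := hσ
  rw [(hderiv σ hσ).deriv]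
  exact mul_neg_of_pos_of_neg (by positivity) (neg_lt_zero.mpr (by positivity))
end

section
/- Let n and c be integers with 0 ≤ c ≤ n−2, let m = n−c−1, and let v, r be reals with v + r(c−1) ≠ 0 and v + r(n−2) ≠ 0. Let M be the m×m real matrix with all diagonal entries equal to v + rc and all off-diagonal entries equal to r, and let 1_m be the all-ones vector in ℝ^m. Then M is invertible and v + rc − r²·(1_mᵀ · M⁻¹ · 1_m) = (v + r(c−1))·(v + r(n−1))/(v + r(n−2)). -/
open Matrix

section ConstantDiagonal

variable {ι K : Type*} [Fintype ι] [DecidableEq ι] [Field K] {M : Matrix ι ι K} {a r : K}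

lemma mulVec_apply_of_const_diag (hM : ∀ i j, M i j = if i = j then a + r else r)
    (x : ι → K) (i : ι) : (M *ᵥ x) i = a * x i + r * ∑ j, x j := by
  have h : ∀ j, M i j * x j = (if i = j then a * x j else 0) + r * x j := by
    intro j
    rw [hM]
    split_ifs <;> ring
  simp [Matrix.mulVec, dotProduct, h, Finset.sum_add_distrib, Finset.mul_sum]

lemma isUnit_of_const_diag (hM : ∀ i j, M i j = if i = j then a + r else r)
    (ha : a ≠ 0) (hb : a + r * Fintype.card ι ≠ 0) : IsUnit M := by
  rw [← Matrix.mulVec_injective_iff_isUnit, ← Matrix.coe_mulVecLin,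
    injective_iff_map_eq_zero]
  intro x hx
  have hx' : ∀ i, a * x i + r * ∑ j, x j = 0 := fun i ↦ by
    rw [← mulVec_apply_of_const_diag hM]
    exact congrFun hx i
  have hsum : (a + r * Fintype.card ι) * ∑ j, x j = 0 := by
    have h := Finset.sum_eq_zero fun i (_ : i ∈ Finset.univ) ↦ hx' i
    rw [Finset.sum_add_distrib, ← Finset.mul_sum, Finset.sum_const, Finset.card_univ,
      nsmul_eq_mul] at h
    linear_combination h
  have hS := (mul_eq_zero.mp hsum).resolve_left hb
  funext i
  simpa [hS, ha] using hx' i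

lemma one_dotProduct_inv_mulVec_one_of_const_diag
    (hM : ∀ i j, M i j = if i = j then a + r else r)
    (ha : a ≠ 0) (hb : a + r * Fintype.card ι ≠ 0) :
    (1 : ι → K) ⬝ᵥ (M⁻¹ *ᵥ (1 : ι → K)) = Fintype.card ι / (a + r * Fintype.card ι) := by
  have hdet := (Matrix.isUnit_iff_isUnit_det M).mp (isUnit_of_const_diag hM ha hb)
  have hone : M *ᵥ ((a + r * Fintype.card ι)⁻¹ • (1 : ι → K)) = 1 := by
    funext i
    rw [mulVec_apply_of_const_diag hM]
    simp only [Pi.smul_apply, Pi.one_apply, smul_eq_mul, mul_one, Finset.sum_const,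
      Finset.card_univ, nsmul_eq_mul]
    field_simp
  have hinv : M⁻¹ *ᵥ (1 : ι → K) = (a + r * Fintype.card ι)⁻¹ • (1 : ι → K) := by
    conv_lhs => rw [← hone]
    rw [Matrix.mulVec_mulVec, Matrix.nonsing_inv_mul M hdet, Matrix.one_mulVec]
  rw [hinv, dotProduct_smul, one_dotProduct_one, smul_eq_mul, div_eq_inv_mul]

end ConstantDiagonal

/-- Sherman–Morrison style identity for the quadratic form of the inverse of
a matrix with constant diagonal `v + rc` and constant off-diagonal `r`. -/
theorem stmt_5 (n c : ℕ) (hc : c + 2 ≤ n) (v r : ℝ)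
    (h1 : v + r * ((c : ℝ) - 1) ≠ 0) (h2 : v + r * ((n : ℝ) - 2) ≠ 0)
    (M : Matrix (Fin (n - c - 1)) (Fin (n - c - 1)) ℝ)
    (hM : ∀ i j, M i j = if i = j then v + r * (c : ℝ) else r) :
    IsUnit M ∧
      v + r * (c : ℝ) -
          r ^ 2 * ((1 : Fin (n - c - 1) → ℝ) ⬝ᵥ (M⁻¹ *ᵥ (1 : Fin (n - c - 1) → ℝ)))
        = (v + r * ((c : ℝ) - 1)) * (v + r * ((n : ℝ) - 1)) / (v + r * ((n : ℝ) - 2)) := by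
  have hcard : v + r * ((c : ℝ) - 1) + r * (Fintype.card (Fin (n - c - 1)) : ℝ)
      = v + r * ((n : ℝ) - 2) := by
    rw [Fintype.card_fin, Nat.sub_sub, Nat.cast_sub (by lia)]
    push_cast
    ring
  have hM' : ∀ i j, M i j = if i = j then v + r * ((c : ℝ) - 1) + r else r := fun i j ↦ by
    rw [hM]
    congr 1
    ring
  have hb := hcard.symm ▸ h2
  refine ⟨isUnit_of_const_diag hM' h1 hb, ?_⟩
  rw [one_dotProduct_inv_mulVec_one_of_const_diag hM' h1 hb, hcard, eq_div_iff h2, sub_mul,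
    mul_assoc, div_mul_cancel₀ _ h2]
  linear_combination -r * hcard
end

section
/- Let n ≥ 2 be an integer, let s, v be reals with v ≥ s > 0, and set r = ((n−2)(v−s) − √((n−2)²(v−s)² + 4(n−1)·v·(v−s)))/(2(n−1)). Then v − r > 0 and v + r(n−1) > 0, and consequently the n×n real matrix with all diagonal entries equal to v and all off-diagonal entries equal to r is positive definite. -/
/-- The matrix with constant diagonal `v` and constant off-diagonal `r ≤ 0` is positive definite
as soon as its row sums are positive. -/
theorem posDef_of_const_diag_offDiag {n : ℕ} {v r : ℝ} (hr : r ≤ 0)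
    (h : 0 < v + r * ((n : ℝ) - 1)) :
    (Matrix.of fun i j : Fin n => if i = j then v else r).PosDef := by
  refine Matrix.PosDef.of_dotProduct_mulVec_pos ?_ fun x hx => ?_
  · ext i j
    simp [Matrix.conjTranspose_apply, eq_comm]
  · have hmulVec : ∀ i, ((Matrix.of fun i j : Fin n => if i = j then v else r).mulVec x) i =
        (v - r) * x i + r * ∑ j, x j := by
      intro i
      have hterm : ∀ j, (if i = j then v else r) * x j =
          (if i = j then (v - r) * x j else 0) + r * x j := by
        intro j
        split_ifs <;> ring
      simp [Matrix.mulVec, dotProduct, hterm, Finset.sum_add_distrib, Finset.mul_sum]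
    have hquad : star x ⬝ᵥ (Matrix.of fun i j : Fin n => if i = j then v else r).mulVec x =
        (v - r) * ∑ i, x i ^ 2 + r * (∑ i, x i) ^ 2 := by
      simp only [dotProduct, hmulVec, Pi.star_apply, star_trivial, mul_add, Finset.sum_add_distrib]
      rw [← Finset.sum_mul, Finset.mul_sum (a := v - r)]
      congr 1
      · exact Finset.sum_congr rfl fun i _ => by ring
      · ring
    obtain ⟨i, hi⟩ := Function.ne_iff.mp hx
    have hpos : 0 < ∑ i, x i ^ 2 :=
      Finset.sum_pos' (fun i _ => sq_nonneg _) ⟨i, Finset.mem_univ i, sq_pos_of_ne_zero hi⟩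
    have hcs : (∑ i, x i) ^ 2 ≤ n * ∑ i, x i ^ 2 := by
      simpa using sq_sum_le_card_mul_sum_sq (s := Finset.univ) (f := x)
    rw [hquad]
    nlinarith [mul_pos h hpos, mul_le_mul_of_nonpos_left hcs hr]


/-- with the optimal anti-correlation `r` (no collusion case), the common
covariance matrix with diagonal `v` and off-diagonal `r` is positive definite. -/
theorem stmt_7 (n : ℕ) (hn : 2 ≤ n) (s v : ℝ) (hs : 0 < s) (hv : s ≤ v)
    (r : ℝ)
    (hr : r = (((n : ℝ) - 2) * (v - s) -
      Real.sqrt (((n : ℝ) - 2) ^ 2 * (v - s) ^ 2 + 4 * ((n : ℝ) - 1) * v * (v - s)))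
      / (2 * ((n : ℝ) - 1))) :
    0 < v - r ∧ 0 < v + r * ((n : ℝ) - 1) ∧
      (Matrix.of fun i j : Fin n => if i = j then v else r).PosDef := by
  have hn' : (2 : ℝ) ≤ n := by exact_mod_cast hn
  have hm : 0 < 2 * ((n : ℝ) - 1) := by linarith
  have hd : 0 ≤ v - s := by linarith
  have hv0 : 0 < v := by linarith
  have hmd : 0 ≤ ((n : ℝ) - 2) * (v - s) := mul_nonneg (by linarith) hd
  have hterm : 0 ≤ 4 * ((n : ℝ) - 1) * v * (v - s) :=
    mul_nonneg (mul_nonneg (by linarith) hv0.le) hd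
  have hr0 : r ≤ 0 := by
    rw [hr]
    refine div_nonpos_of_nonpos_of_nonneg (sub_nonpos.mpr (Real.le_sqrt_of_sq_le ?_)) hm.le
    linarith [mul_pow ((n : ℝ) - 2) (v - s) 2]
  have hrow : 0 < v + r * ((n : ℝ) - 1) := by
    have hsqrt : Real.sqrt (((n : ℝ) - 2) ^ 2 * (v - s) ^ 2 + 4 * ((n : ℝ) - 1) * v * (v - s)) <
        2 * v + ((n : ℝ) - 2) * (v - s) := by
      rw [Real.sqrt_lt' (by linarith)]
      nlinarith [mul_pos hv0 hs]
    rw [eq_div_iff hm.ne'] at hr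
    linarith
  exact ⟨by linarith, hrow, posDef_of_const_diag_offDiag hr0 hrow⟩
end

section
/- Let n ≥ 2 be an integer, let s, v be reals with v ≥ s > 0, and set r = −v(v−s)/(v(n−1) − s(n−2)). Then v(n−1) − s(n−2) > 0, v + r(n−1) = v·s/(v(n−1) − s(n−2)) > 0, and the (n−1)×(n−1) real matrix with all diagonal entries equal to v + r and all off-diagonal entries equal to r is positive definite. -/
/-- The real matrix `a • 1 + b • J`, with `J` the all-ones matrix, is positive definite as soon as
its two eigenvalues `a` and `a + b * card ι` are positive. -/
theorem posDef_of_add_diagonal_const {ι : Type*} [Fintype ι] [DecidableEq ι] {a b : ℝ}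
    (ha : 0 < a) (hab : 0 < a + b * Fintype.card ι) :
    (Matrix.of fun i j : ι => if i = j then a + b else b).PosDef := by
  refine Matrix.PosDef.of_dotProduct_mulVec_pos ?_ fun x hx => ?_
  · ext i j
    simp [Matrix.conjTranspose_apply, eq_comm]
  have hquad : dotProduct (star x) ((Matrix.of fun i j : ι => if i = j then a + b else b).mulVec x) =
      a * ∑ i, x i ^ 2 + b * (∑ i, x i) ^ 2 := by
    have hrow (i : ι) : ((Matrix.of fun i j : ι => if i = j then a + b else b).mulVec x) i =
        a * x i + b * ∑ j, x j := by
      have hentry (j : ι) : (if i = j then a + b else b) * x j =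
          (if i = j then a * x j else 0) + b * x j := by
        split_ifs <;> ring
      simp [Matrix.mulVec, dotProduct, hentry, Finset.sum_add_distrib, Finset.mul_sum]
    simp only [dotProduct, hrow, star_trivial, mul_add, Finset.sum_add_distrib]
    rw [← Finset.sum_mul]
    congr 1
    · rw [Finset.mul_sum]
      exact Finset.sum_congr rfl fun i _ => by ring
    · ring
  have hpos : 0 < ∑ i, x i ^ 2 := by
    obtain ⟨i, hi⟩ := Function.ne_iff.mp hx
    exact Finset.sum_pos' (fun j _ => sq_nonneg (x j)) ⟨i, Finset.mem_univ i, sq_pos_of_ne_zero hi⟩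
  have hcs : (∑ i, x i) ^ 2 ≤ Fintype.card ι * ∑ i, x i ^ 2 := sq_sum_le_card_mul_sum_sq
  rw [hquad]
  rcases le_total 0 b with hb | hb
  · positivity
  · nlinarith [mul_le_mul_of_nonpos_left hcs hb, mul_pos hab hpos]

/-- with the optimal `r` in the single-colluder case, the
`(n−1)×(n−1)` matrix with diagonal `v + r` and off-diagonal `r` is positive definite. -/
theorem stmt_8 (n : ℕ) (hn : 2 ≤ n) (s v : ℝ) (hs : 0 < s) (hv : s ≤ v)
    (r : ℝ) (hr : r = -(v * (v - s)) / (v * ((n : ℝ) - 1) - s * ((n : ℝ) - 2))) :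
    0 < v * ((n : ℝ) - 1) - s * ((n : ℝ) - 2) ∧
    v + r * ((n : ℝ) - 1) = v * s / (v * ((n : ℝ) - 1) - s * ((n : ℝ) - 2)) ∧
    0 < v + r * ((n : ℝ) - 1) ∧
    (Matrix.of fun i j : Fin (n - 1) => if i = j then v + r else r).PosDef := by
  have hn' : (2 : ℝ) ≤ n := by exact_mod_cast hn
  have hv₀ : 0 < v := hs.trans_le hv
  have hD : 0 < v * ((n : ℝ) - 1) - s * ((n : ℝ) - 2) := by
    nlinarith [mul_nonneg (sub_nonneg.2 hv) (sub_nonneg.2 hn')]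
  have heq : v + r * ((n : ℝ) - 1) = v * s / (v * ((n : ℝ) - 1) - s * ((n : ℝ) - 2)) := by
    rw [hr, eq_div_iff hD.ne', add_mul, mul_right_comm, div_mul_cancel₀ _ hD.ne']
    ring
  have hpos : 0 < v + r * ((n : ℝ) - 1) := heq ▸ div_pos (mul_pos hv₀ hs) hD
  refine ⟨hD, heq, hpos, posDef_of_add_diagonal_const hv₀ ?_⟩
  rwa [Fintype.card_fin, Nat.cast_sub (by omega), Nat.cast_one]
end

section
/- Let n and c be integers with 2 ≤ c ≤ n−1, let s, v be reals with v ≥ s > 0, and set r = (−(n−2)(v−s) − vc + √(((n−2)(v−s) − vc)² + 4(n−c−1)·v·(v−s)))/(2(n−1)(c−1)). Then v + r(n−1) > 0 and v + r(c−1) > 0, and the (n−c)×(n−c) real matrix with all diagonal entries equal to v + rc and all off-diagonal entries equal to r is positive definite. -/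
theorem posDef_of_diag_offDiag {m : ℕ} (a r : ℝ) (hr : r ≤ 0) (h : 0 < a - r + r * m) :
    (Matrix.of fun i j : Fin m => if i = j then a else r).PosDef := by
  refine Matrix.PosDef.of_dotProduct_mulVec_pos ?_ fun x hx => ?_
  · ext i j
    simp [Matrix.conjTranspose_apply, eq_comm]
  · have hform : star x ⬝ᵥ ((Matrix.of fun i j : Fin m => if i = j then a else r).mulVec x)
        = (a - r) * ∑ i, x i ^ 2 + r * (∑ i, x i) ^ 2 := by
      have hrow (i : Fin m) : ∑ j, (if i = j then a else r) * x j
          = (a - r) * x i + r * ∑ j, x j := by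
        have hterm (j : Fin m) : (if i = j then a else r) * x j
            = (if i = j then (a - r) * x j else 0) + r * x j := by
          split_ifs <;> ring
        simp only [hterm, Finset.sum_add_distrib, Finset.mul_sum, Finset.sum_ite_eq,
          Finset.mem_univ, if_true]
      simp only [dotProduct, Matrix.mulVec, Matrix.of_apply, hrow, star_trivial, mul_add,
        Finset.sum_add_distrib, ← Finset.sum_mul]
      congr 1
      · rw [Finset.mul_sum]
        exact Finset.sum_congr rfl fun i _ => by ring
      · ring
    have hcs : (∑ i, x i) ^ 2 ≤ m * ∑ i, x i ^ 2 := by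
      simpa using sq_sum_le_card_mul_sum_sq (s := Finset.univ) (f := x)
    have hpos : 0 < ∑ i, x i ^ 2 := by
      obtain ⟨i, hi⟩ := Function.ne_iff.mp hx
      exact Finset.sum_pos' (fun i _ => sq_nonneg _) ⟨i, Finset.mem_univ i, by
        have : x i ≠ 0 := hi
        positivity⟩
    rw [hform]
    nlinarith [mul_le_mul_of_nonpos_left hcs hr, mul_pos h hpos]

/-- with the optimal `r` in the case of `c ≥ 2` colluders, the
`(n−c)×(n−c)` matrix with diagonal `v + rc` and off-diagonal `r` is positive definite. -/
theorem stmt_9 (n c : ℕ) (hc2 : 2 ≤ c) (hcn : c + 1 ≤ n)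
    (s v : ℝ) (hs : 0 < s) (hv : s ≤ v) (r : ℝ)
    (hr : r = (-(((n : ℝ) - 2) * (v - s)) - v * (c : ℝ) +
      Real.sqrt ((((n : ℝ) - 2) * (v - s) - v * (c : ℝ)) ^ 2 +
        4 * ((n : ℝ) - (c : ℝ) - 1) * v * (v - s)))
      / (2 * ((n : ℝ) - 1) * ((c : ℝ) - 1))) :
    0 < v + r * ((n : ℝ) - 1) ∧ 0 < v + r * ((c : ℝ) - 1) ∧
    (Matrix.of fun i j : Fin (n - c) => if i = j then v + r * (c : ℝ) else r).PosDef := by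
  have hc : (2 : ℝ) ≤ c := by exact_mod_cast hc2
  have hn : (c : ℝ) + 1 ≤ n := by exact_mod_cast hcn
  have hd : 0 ≤ v - s := by linarith
  have hv0 : 0 < v := by linarith
  have hden : 0 < 2 * ((n : ℝ) - 1) * ((c : ℝ) - 1) :=
    mul_pos (by linarith) (by linarith)
  set S := Real.sqrt ((((n : ℝ) - 2) * (v - s) - v * (c : ℝ)) ^ 2 +
        4 * ((n : ℝ) - (c : ℝ) - 1) * v * (v - s)) with hS
  have hvd : 0 ≤ v * (v - s) := mul_nonneg hv0.le hd
  have hS_le : S ≤ ((n : ℝ) - 2) * (v - s) + v * c := by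
    refine Real.sqrt_le_iff.mpr ⟨?_, ?_⟩
    · have : 0 ≤ ((n : ℝ) - 2) * (v - s) := mul_nonneg (by linarith) hd
      positivity
    · have h1 : 0 ≤ ((n : ℝ) - 2) * c - (n - c - 1) := by nlinarith
      nlinarith [mul_nonneg hvd h1]
  have hlt_S : ((n : ℝ) - 2) * (v - s) - v * (c - 2) < S := by
    refine Real.lt_sqrt_of_sq_lt ?_
    have h1 : 0 < v * (((c : ℝ) - 1) * s) := mul_pos hv0 (mul_pos (by linarith) hs)
    linarith
  have hmul : r * (2 * ((n : ℝ) - 1) * ((c : ℝ) - 1))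
      = -(((n : ℝ) - 2) * (v - s)) - v * (c : ℝ) + S := by
    rw [hr, div_mul_cancel₀ _ hden.ne']
  have hr0 : r ≤ 0 := by
    rw [hr]
    exact div_nonpos_of_nonpos_of_nonneg (by linarith) hden.le
  have hvn : 0 < v + r * ((n : ℝ) - 1) := by
    have h1 : 0 < (v + r * ((n : ℝ) - 1)) * (2 * ((c : ℝ) - 1)) := by linarith
    exact pos_of_mul_pos_left h1 (by linarith)
  refine ⟨hvn, by nlinarith, posDef_of_diag_offDiag _ _ hr0 ?_⟩
  rw [Nat.cast_sub (by omega)]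
  linarith
end

section
/- For every integer n ≥ 2 and every real s > 0, the function F(v) = v + ((n−2)(v−s) − √((n−2)²(v−s)² + 4(n−1)·v·(v−s)))/2 is strictly decreasing on the interval [s, ∞). -/
/-- The increment form of: `w ↦ a w - √(a² w² + c w)` is strictly decreasing on `[0, ∞)`. -/
theorem mul_add_sqrt_lt_sqrt_of_lt {a c x y : ℝ} (ha : 0 < a) (hc : 0 < c) (hx : 0 ≤ x)
    (hxy : x < y) :
    a * (y - x) + √(a ^ 2 * x ^ 2 + c * x) < √(a ^ 2 * y ^ 2 + c * y) := by
  have hQ : 0 ≤ a ^ 2 * x ^ 2 + c * x := by positivity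
  have hd : 0 < y - x := sub_pos.mpr hxy
  have key : 2 * a * √(a ^ 2 * x ^ 2 + c * x) < c + 2 * a ^ 2 * x := by
    apply lt_of_pow_lt_pow_left₀ 2 (by positivity)
    rw [mul_pow, Real.sq_sqrt hQ]
    nlinarith [pow_pos hc 2]
  apply Real.lt_sqrt_of_sq_lt
  rw [add_sq, Real.sq_sqrt hQ]
  nlinarith [mul_lt_mul_of_pos_left key hd]

/-- `F(v) = v + ((n−2)(v−s) − √((n−2)²(v−s)² + 4(n−1)v(v−s)))/2` is
strictly decreasing on `[s, ∞)`. -/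
theorem stmt_10 (n : ℕ) (hn : 2 ≤ n) (s : ℝ) (hs : 0 < s) :
    StrictAntiOn (fun v : ℝ => v + (((n : ℝ) - 2) * (v - s) -
      Real.sqrt (((n : ℝ) - 2) ^ 2 * (v - s) ^ 2 + 4 * ((n : ℝ) - 1) * v * (v - s))) / 2)
      (Set.Ici s) := by
  intro x hx y _ hxy
  have hn' : (2 : ℝ) ≤ n := by exact_mod_cast hn
  have hc : 0 < 4 * ((n : ℝ) - 1) * s := mul_pos (by linarith) hs
  have radicand (v : ℝ) : ((n : ℝ) - 2) ^ 2 * (v - s) ^ 2 + 4 * ((n : ℝ) - 1) * v * (v - s) =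
      (n : ℝ) ^ 2 * (v - s) ^ 2 + 4 * ((n : ℝ) - 1) * s * (v - s) := by ring
  have h := mul_add_sqrt_lt_sqrt_of_lt (a := n) (by linarith) hc
    (sub_nonneg.mpr hx) (sub_lt_sub_right hxy s)
  simp only [radicand]
  linarith
end

section
/- Let n ≥ 2 and c be integers with 0 ≤ c ≤ n−2, and let s > 0 be real. Define the feasible set F = {(v, r) ∈ ℝ×ℝ : v ≥ s, v − r ≥ 0, v + r(n−1) > 0, and r²(n−1)(c−1) + r·(v(n+c−2) − s(n−2)) + v(v−s) ≥ 0}. Then the infimum of {v + r(n−1) : (v, r) ∈ F} equals s/(n−c), and this infimum is not attained by any element of F. -/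
/-- In the coordinates `(v, y)` with `y = v + r(n−1)`, the quadratic constraint becomes affine
in `v`. -/
theorem quadratic_constraint_iff (n c s v r : ℝ) (hn : 0 < n - 1) :
    0 ≤ r ^ 2 * (n - 1) * (c - 1) + r * (v * (n + c - 2) - s * (n - 2)) + v * (v - s) ↔
      (v + r * (n - 1)) * (s * (n - 2) - (v + r * (n - 1)) * (c - 1)) ≤
        v * ((v + r * (n - 1)) * (n - c) - s) := by
  have h : v * ((v + r * (n - 1)) * (n - c) - s) -
      (v + r * (n - 1)) * (s * (n - 2) - (v + r * (n - 1)) * (c - 1)) =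
      (n - 1) * (r ^ 2 * (n - 1) * (c - 1) + r * (v * (n + c - 2) - s * (n - 2)) +
        v * (v - s)) := by ring
  rw [← mul_nonneg_iff_of_pos_left hn, ← h, sub_nonneg]

/-- the infimum of `v + r(n−1)` over the privacy-feasible region
equals `s/(n−c)` and is not attained. -/
theorem stmt_14 (n c : ℕ) (hn : 2 ≤ n) (hc : c + 2 ≤ n) (s : ℝ) (hs : 0 < s)
    (S : Set ℝ)
    (hS : S = {y : ℝ | ∃ v r : ℝ,
      (s ≤ v ∧ 0 ≤ v - r ∧ 0 < v + r * ((n : ℝ) - 1) ∧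
        0 ≤ r ^ 2 * ((n : ℝ) - 1) * ((c : ℝ) - 1) +
            r * (v * ((n : ℝ) + (c : ℝ) - 2) - s * ((n : ℝ) - 2)) + v * (v - s)) ∧
      y = v + r * ((n : ℝ) - 1)}) :
    sInf S = s / ((n : ℝ) - (c : ℝ)) ∧ s / ((n : ℝ) - (c : ℝ)) ∉ S := by
  have hn' : (2 : ℝ) ≤ n := by exact_mod_cast hn
  have hc' : (c : ℝ) + 2 ≤ n := by exact_mod_cast hc
  have hc0 : (0 : ℝ) ≤ c := c.cast_nonneg
  have hN : (0 : ℝ) < n - 1 := by linarith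
  have hk : (0 : ℝ) < n - c := by linarith
  suffices hI : S = Set.Ioi (s / ((n : ℝ) - c)) by
    rw [hI]
    exact ⟨csInf_Ioi, Set.self_notMem_Ioi⟩
  rw [hS]
  ext y
  simp only [Set.mem_ofPred_eq, Set.mem_Ioi]
  constructor
  · rintro ⟨v, r, ⟨hv, -, hy, hq⟩, rfl⟩
    rw [quadratic_constraint_iff _ _ _ _ _ hN] at hq
    set y := v + r * ((n : ℝ) - 1)
    rw [div_lt_iff₀ hk]
    by_contra! hle
    have hys : y ≤ s := by nlinarith
    have hpos : 0 < s * ((n : ℝ) - 2) - y * ((c : ℝ) - 1) := by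
      nlinarith [mul_nonneg hc0 (sub_nonneg.2 hys),
        mul_nonneg hs.le (sub_nonneg.2 hc')]
    have := mul_pos hy hpos
    nlinarith
  · intro hy
    have hy0 : 0 < y := (div_pos hs hk).trans hy
    have hd : 0 < y * ((n : ℝ) - c) - s := by
      rw [div_lt_iff₀ hk] at hy
      linarith
    have hnum : 0 ≤ y * (s * ((n : ℝ) - 2) + y) :=
      mul_nonneg hy0.le (add_nonneg (mul_nonneg hs.le (by linarith)) hy0.le)
    set q := y * (s * ((n : ℝ) - 2) + y) / (y * ((n : ℝ) - c) - s) with hq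
    have hq0 : 0 ≤ q := div_nonneg hnum hd.le
    have hqd : q * (y * ((n : ℝ) - c) - s) = y * (s * ((n : ℝ) - 2) + y) :=
      div_mul_cancel₀ _ hd.ne'
    obtain ⟨v, hv⟩ : ∃ v, v = s + y + q := ⟨_, rfl⟩
    have hyr : v + (y - v) / ((n : ℝ) - 1) * ((n : ℝ) - 1) = y := by
      rw [div_mul_cancel₀ _ hN.ne']
      ring
    refine ⟨v, (y - v) / ((n : ℝ) - 1), ⟨by linarith, ?_, by rwa [hyr], ?_⟩, hyr.symm⟩
    · have : (y - v) / ((n : ℝ) - 1) ≤ 0 := div_nonpos_of_nonpos_of_nonneg (by linarith) hN.le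
      linarith
    · rw [quadratic_constraint_iff _ _ _ _ _ hN, hyr]
      have h1 := mul_nonneg (add_pos hs hy0).le hd.le
      have h2 := mul_nonneg (mul_nonneg hy0.le hy0.le) hc0
      rw [hv]
      linarith
end

section
/- Let n and t be integers with n ≥ 2 and 1 ≤ t < n, and let s > 0 be real. For v ≥ s define r_*(v) = ((n−2)(v−s) − √((n−2)²(v−s)² + 4(n−1)·v·(v−s)))/(2(n−1)) and G(v) = v + (t−1)·r_*(v). Let v* = s·(n² − 2n + 2)/n² + s·(n−1)·(n + t(n−2))/(n²·√(t·(n−t)·(n−1))). Then v* ≥ s, and G(v) ≥ G(v*) for every v ≥ s; that is, G attains its global minimum over [s, ∞) at v*. -/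
/-- Reversed Cauchy-Schwarz inequality for the Lorentzian form `y ^ 2 - S ^ 2` in the plane. -/
theorem lorentz_mul_le {a b R y S c : ℝ} (ha : 0 ≤ a) (hba : b ≤ a)
    (hS : 0 ≤ S) (hSy : S ≤ y) (hR : a ^ 2 - b ^ 2 = R ^ 2) (hc : y ^ 2 - S ^ 2 = c ^ 2) :
    R * c ≤ a * y - b * S := by
  refine le_of_abs_le (abs_le_of_sq_le_sq ?_ ?_)
  · have : (a * y - b * S) ^ 2 - (R * c) ^ 2 = (a * S - b * y) ^ 2 := by
      rw [mul_pow, ← hR, ← hc]; ring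
    nlinarith [sq_nonneg (a * S - b * y)]
  · nlinarith [mul_le_mul_of_nonneg_right hba hS, mul_le_mul_of_nonneg_left hSy ha]


/-- the optimal noise variance in the dropout case without collusion. -/
theorem stmt_15 (n t : ℕ) (hn : 2 ≤ n) (ht1 : 1 ≤ t) (htn : t < n)
    (s : ℝ) (hs : 0 < s)
    (rstar G : ℝ → ℝ)
    (hr : ∀ v : ℝ, rstar v = (((n : ℝ) - 2) * (v - s) -
        Real.sqrt (((n : ℝ) - 2) ^ 2 * (v - s) ^ 2 + 4 * ((n : ℝ) - 1) * v * (v - s)))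
        / (2 * ((n : ℝ) - 1)))
    (hG : ∀ v : ℝ, G v = v + ((t : ℝ) - 1) * rstar v)
    (vstar : ℝ)
    (hv : vstar = s * ((n : ℝ) ^ 2 - 2 * (n : ℝ) + 2) / (n : ℝ) ^ 2 +
      s * ((n : ℝ) - 1) * ((n : ℝ) + (t : ℝ) * ((n : ℝ) - 2)) /
        ((n : ℝ) ^ 2 * Real.sqrt ((t : ℝ) * ((n : ℝ) - (t : ℝ)) * ((n : ℝ) - 1)))) :
    s ≤ vstar ∧ ∀ v : ℝ, s ≤ v → G vstar ≤ G v := by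
  have hN : (2 : ℝ) ≤ n := by exact_mod_cast hn
  have hT : (1 : ℝ) ≤ t := by exact_mod_cast ht1
  have hTN : (t : ℝ) < n := by exact_mod_cast htn
  generalize (n : ℝ) = N at *
  generalize (t : ℝ) = T at *
  have hN0 : 0 < N := by linarith
  have hN1 : 0 < N - 1 := by linarith
  have hTN0 : 0 < N - T := by linarith
  have hP : 0 < T * (N - T) * (N - 1) := by positivity
  set R := √(T * (N - T) * (N - 1)) with hRdef
  have hR : 0 < R := Real.sqrt_pos.2 hP
  have hR2 : R ^ 2 = T * (N - T) * (N - 1) := Real.sq_sqrt hP.le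
  obtain ⟨A, hA⟩ : ∃ A, A = N + T * (N - 2) := ⟨_, rfl⟩
  have hA0 : 0 < A := by nlinarith
  have hAB : N * (T - 1) ≤ A := by linarith
  have hAR : A ^ 2 - (N * (T - 1)) ^ 2 = (2 * R) ^ 2 := by
    rw [hA]; linear_combination -4 * hR2
  have hRA : 2 * R ≤ A :=
    (sq_le_sq₀ (by positivity) hA0.le).1 (by nlinarith [sq_nonneg (N * (T - 1))])
  obtain ⟨c, hc⟩ : ∃ c, c = 2 * (N - 1) * s / N := ⟨_, rfl⟩
  have hc0 : 0 < c := by rw [hc]; positivity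
  have hcN : c * N = 2 * (N - 1) * s := by rw [hc]; field_simp
  have hrad : ∀ v, (N - 2) ^ 2 * (v - s) ^ 2 + 4 * (N - 1) * v * (v - s) =
      (N * (v - s) + c) ^ 2 - c ^ 2 := fun v => by
    linear_combination (-2 * (v - s)) * hcN
  have hGv : ∀ v, G v = s + (A * (N * (v - s) + c) -
      N * (T - 1) * √((N * (v - s) + c) ^ 2 - c ^ 2) - A * c) / (2 * N * (N - 1)) := fun v => by
    rw [hG, hr, hrad, hA]
    field_simp
    ring
  have hvs : N * (vstar - s) + c = A * c / (2 * R) := by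
    rw [hv, ← hA, hc]
    field_simp
    ring
  have hsqrt : √((A * c / (2 * R)) ^ 2 - c ^ 2) = N * (T - 1) * c / (2 * R) := by
    have hT1 : 0 ≤ T - 1 := by linarith
    rw [← Real.sqrt_sq (by positivity : 0 ≤ N * (T - 1) * c / (2 * R))]
    congr 1
    field_simp
    linear_combination hAR
  refine ⟨?_, fun v hsv => ?_⟩
  · have : c ≤ A * c / (2 * R) := by
      rw [le_div_iff₀ (by positivity)]; nlinarith
    nlinarith
  · have hx : 0 ≤ N * (v - s) := mul_nonneg hN0.le (by linarith)
    have hy : 0 ≤ N * (v - s) + c := by linarith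
    have hD : 0 ≤ (N * (v - s) + c) ^ 2 - c ^ 2 := by nlinarith
    have key := lorentz_mul_le hA0.le hAB (Real.sqrt_nonneg ((N * (v - s) + c) ^ 2 - c ^ 2))
      (Real.sqrt_le_iff.2 ⟨hy, by nlinarith⟩) hAR (c := c) (by rw [Real.sq_sqrt hD]; ring)
    have hmin : A * (A * c / (2 * R)) - N * (T - 1) * (N * (T - 1) * c / (2 * R)) = 2 * R * c := by
      field_simp
      linear_combination hAR
    rw [hGv, hGv v, hvs, hsqrt, hmin]
    gcongr
end

section
/- Let n, t, c be integers with 2 ≤ c < t < n, and let s > 0 be real. For v ≥ s define r_*(v) = (−(n−2)(v−s) − vc + √(((n−2)(v−s) − vc)² + 4(n−c−1)·v·(v−s)))/(2(n−1)(c−1)) and G(v) = v + (t−1)·r_*(v). Let v* = s·(n² − 2n − cn + 2)/(n−c)² + s·(n−c−1)·(n + c − 2nc + t(n+c−2))/((n−c)²·√((t−c)·(n−t)·(n−c−1))). Then v* ≥ s, and G(v) ≥ G(v*) for every v ≥ s; that is, G attains its global minimum over [s, ∞) at v*. -/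
/-- The tangent line inequality for the branch of hyperbola `y = √(α x² + D)`. -/
theorem sqrt_hyperbola_tangent_le {α D x x₀ q₀ : ℝ} (hα : 0 ≤ α) (hD : 0 ≤ D) (hq₀ : 0 < q₀)
    (h₀ : q₀ ^ 2 = α * x₀ ^ 2 + D) :
    q₀ + α * x₀ * (x - x₀) / q₀ ≤ √(α * x ^ 2 + D) := by
  have h : q₀ + α * x₀ * (x - x₀) / q₀ = (D + α * x * x₀) / q₀ := by
    field_simp
    linear_combination h₀
  rw [h]
  apply Real.le_sqrt_of_sq_le
  rw [div_pow, div_le_iff₀ (by positivity), h₀]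
  nlinarith [mul_nonneg (mul_nonneg hα hD) (sq_nonneg (x - x₀))]

/-- The bound that places the stationary point to the right of the threshold, in terms of
`a = n - c`, `d = c - 1` and `τ = t - c`. -/
theorem stationary_point_bound {a d τ S : ℝ} (hd : 0 ≤ d) (hτ : 1 ≤ τ) (ha : τ + 1 ≤ a)
    (hS : 0 ≤ S) (hS2 : S ^ 2 = τ * (a - τ) * (a - 1)) :
    S * (a - d * (a - 2)) ≤ (a - 1) * (τ * a + d * (2 * τ - a)) := by
  have hP : 0 ≤ (τ - 1) * (a - 1 - τ) := mul_nonneg (by linarith) (by linarith)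
  have h1 : S ≤ (a - 1) * τ := by
    refine le_of_abs_le (abs_le_of_sq_le_sq ?_ (mul_nonneg (by linarith) (by linarith)))
    have : 0 ≤ (a - 1) * τ * (a * (τ - 1)) :=
      mul_nonneg (mul_nonneg (by linarith) (by linarith))
        (mul_nonneg (by linarith) (by linarith))
    rw [hS2]
    linarith
  have h2 : (a - 1) * (a - 2 * τ) ≤ S * (a - 2) := by
    refine le_of_abs_le (abs_le_of_sq_le_sq ?_ (mul_nonneg hS (by linarith)))
    have : 0 ≤ (a - 1) * a ^ 2 * ((τ - 1) * (a - 1 - τ)) :=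
      mul_nonneg (mul_nonneg (by linarith) (sq_nonneg a)) hP
    rw [mul_pow S, hS2]
    linarith
  have h3 := mul_le_mul_of_nonneg_right h1 (by linarith : 0 ≤ a)
  have h4 := mul_le_mul_of_nonneg_left h2 hd
  linarith

/-- the optimal noise variance in the dropout case with `c ≥ 2` colluders. -/
theorem stmt_16 (n t c : ℕ) (hc2 : 2 ≤ c) (hct : c < t) (htn : t < n)
    (s : ℝ) (hs : 0 < s)
    (rstar G : ℝ → ℝ)
    (hr : ∀ v : ℝ, rstar v = (-(((n : ℝ) - 2) * (v - s)) - v * (c : ℝ) +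
        Real.sqrt ((((n : ℝ) - 2) * (v - s) - v * (c : ℝ)) ^ 2 +
          4 * ((n : ℝ) - (c : ℝ) - 1) * v * (v - s)))
        / (2 * ((n : ℝ) - 1) * ((c : ℝ) - 1)))
    (hG : ∀ v : ℝ, G v = v + ((t : ℝ) - 1) * rstar v)
    (vstar : ℝ)
    (hv : vstar = s * ((n : ℝ) ^ 2 - 2 * (n : ℝ) - (c : ℝ) * (n : ℝ) + 2) /
        ((n : ℝ) - (c : ℝ)) ^ 2 +
      s * ((n : ℝ) - (c : ℝ) - 1) *
          ((n : ℝ) + (c : ℝ) - 2 * (n : ℝ) * (c : ℝ) + (t : ℝ) * ((n : ℝ) + (c : ℝ) - 2)) /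
        (((n : ℝ) - (c : ℝ)) ^ 2 *
          Real.sqrt (((t : ℝ) - (c : ℝ)) * ((n : ℝ) - (t : ℝ)) * ((n : ℝ) - (c : ℝ) - 1)))) :
    s ≤ vstar ∧ ∀ v : ℝ, s ≤ v → G vstar ≤ G v := by
  have hc : (2 : ℝ) ≤ c := by exact_mod_cast hc2
  have ht : (c : ℝ) + 1 ≤ t := by exact_mod_cast hct
  have hn : (t : ℝ) + 1 ≤ n := by exact_mod_cast htn
  generalize (n : ℝ) = n at *
  generalize (t : ℝ) = t at *
  generalize (c : ℝ) = c at *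
  obtain ⟨d, rfl⟩ : ∃ d, c = d + 1 := ⟨c - 1, by ring⟩
  obtain ⟨τ, rfl⟩ : ∃ τ, t = d + 1 + τ := ⟨t - (d + 1), by ring⟩
  obtain ⟨a, rfl⟩ : ∃ a, n = a + d + 1 := ⟨n - d - 1, by ring⟩
  have hd : 1 ≤ d := by linarith
  have hτ : 1 ≤ τ := by linarith
  have ha : τ + 1 ≤ a := by linarith
  have hd0 : 0 < d := by linarith
  have ha0 : 0 < a := by linarith
  have ha1 : 0 < a - 1 := by linarith
  have had : 0 < a + d := by linarith
  have hdτ : 0 < d + τ := by linarith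
  have hS2pos : 0 < τ * (a - τ) * (a - 1) :=
    mul_pos (mul_pos (by linarith) (by linarith)) ha1
  obtain ⟨S, hS⟩ : ∃ S, S = √(τ * (a - τ) * (a - 1)) := ⟨_, rfl⟩
  have hSpos : 0 < S := hS ▸ Real.sqrt_pos.2 hS2pos
  have hS2 : S ^ 2 = τ * (a - τ) * (a - 1) := hS ▸ Real.sq_sqrt hS2pos.le
  obtain ⟨B, hB⟩ : ∃ B, B = τ * a + d * (2 * τ - a) := ⟨_, rfl⟩
  obtain ⟨m, hm⟩ : ∃ m, m = s * ((a + d + 1) * (a - 2) + 2) / a ^ 2 := ⟨_, rfl⟩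
  obtain ⟨x₀, hx₀⟩ : ∃ x₀, x₀ = s * (a - 1) * B / (a ^ 2 * S) := ⟨_, rfl⟩
  have hvs : vstar = m + x₀ := by
    rw [hv, hm, hx₀, hB, hS]
    ring_nf
  refine ⟨?_, fun v _ => ?_⟩
  · have key := stationary_point_bound hd0.le hτ ha hSpos.le hS2
    rw [← hB] at key
    have h : vstar - s = s * ((a - 1) * B - S * (a - d * (a - 2))) / (a ^ 2 * S) := by
      rw [hvs, hm, hx₀]
      field_simp
      ring
    have : 0 ≤ vstar - s := by
      rw [h]
      exact div_nonneg (mul_nonneg hs.le (by linarith)) (by positivity)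
    linarith
  · obtain ⟨D, hD⟩ : ∃ D, D = 4 * d * (a + d) * (a - 1) * s ^ 2 / a ^ 2 := ⟨_, rfl⟩
    have hD0 : 0 ≤ D := by rw [hD]; positivity
    obtain ⟨q₀, hq₀⟩ : ∃ q₀, q₀ = (d + τ) * s * (a - 1) / S := ⟨_, rfl⟩
    have hq₀pos : 0 < q₀ := by rw [hq₀]; positivity
    have hq₀2 : q₀ ^ 2 = a ^ 2 * x₀ ^ 2 + D := by
      rw [hq₀, hx₀, hD]
      field_simp
      rw [hS2, hB]
      ring
    have hstat : a ^ 2 * x₀ / q₀ = B / (d + τ) := by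
      rw [hq₀, hx₀]
      field_simp
    have hGv : ∀ w, G w = (2 * (a + d) * d)⁻¹ *
        ((d + τ) * √(a ^ 2 * (w - m) ^ 2 + D) - B * w + (d + τ) * (a + d - 1) * s) := by
      intro w
      have hQ : ((a + d + 1 - 2) * (w - s) - w * (d + 1)) ^ 2 +
          4 * (a + d + 1 - (d + 1) - 1) * w * (w - s) = a ^ 2 * (w - m) ^ 2 + D := by
        rw [hm, hD]
        field_simp
        ring
      rw [hG, hr, hQ, hB, add_sub_cancel_right, add_sub_cancel_right]
      field_simp
      ring
    have htan := sqrt_hyperbola_tangent_le (x := v - m) (sq_nonneg a) hD0 hq₀pos hq₀2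
    rw [mul_div_right_comm, hstat] at htan
    have hmul := mul_le_mul_of_nonneg_left htan hdτ.le
    have hlin : (d + τ) * (q₀ + B / (d + τ) * (v - m - x₀)) =
        (d + τ) * q₀ + B * (v - m - x₀) := by
      field_simp
    rw [hlin] at hmul
    rw [hGv, hGv v, hvs, add_sub_cancel_left, ← hq₀2, Real.sqrt_sq hq₀pos.le]
    refine mul_le_mul_of_nonneg_left ?_ (by positivity)
    linarith
end

section
/- Let Σ be an n×n real symmetric positive definite matrix. Then Σ̃ = (1/n!)·Σ_{σ ∈ S_n} P_σ·Σ·P_σᵀ is symmetric positive definite, and MSE(Σ̃) ≤ MSE(Σ). -/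
open Matrix

theorem permMatrix_mul_mul_transpose {ι R : Type*} [Fintype ι] [DecidableEq ι] [NonAssocSemiring R]
    (σ : Equiv.Perm ι) (A : Matrix ι ι R) :
    σ.permMatrix R * A * (σ.permMatrix R)ᵀ = A.submatrix σ σ := by
  rw [transpose_permMatrix, Equiv.Perm.permMatrix, Equiv.Perm.permMatrix,
    PEquiv.toMatrix_toPEquiv_mul, PEquiv.mul_toMatrix_toPEquiv]
  rfl

theorem sum_submatrix_perm {ι R : Type*} [AddCommMonoid R] (σ : Equiv.Perm ι)
    (A : Matrix ι ι R) (U : Finset ι) :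
    ∑ i ∈ U, ∑ j ∈ U, A.submatrix σ σ i j =
      ∑ i ∈ U.map σ.toEmbedding, ∑ j ∈ U.map σ.toEmbedding, A i j := by
  simp

theorem posDef_inv_factorial_smul_sum_submatrix_perm {n : ℕ} {A : Matrix (Fin n) (Fin n) ℝ}
    (hA : A.PosDef) :
    ((n.factorial : ℝ)⁻¹ • ∑ σ : Equiv.Perm (Fin n), A.submatrix σ σ).PosDef :=
  (posDef_sum Finset.univ_nonempty fun σ _ => hA.submatrix σ.injective).smul (by positivity)

/-- symmetrizing a positive definite covariance matrix over all
permutations does not increase the worst-case MSE. -/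
theorem stmt_17 (n d t : ℕ) (hn : 1 ≤ n) (hd : 1 ≤ d) (ht1 : 1 ≤ t) (htn : t ≤ n)
    (MSE : Matrix (Fin n) (Fin n) ℝ → ℝ)
    (hMSE : ∀ A : Matrix (Fin n) (Fin n) ℝ,
      MSE A = ⨆ U : {U : Finset (Fin n) // t ≤ U.card},
        ((d : ℝ) / ((U.1.card : ℝ)) ^ 2) * ∑ i ∈ U.1, ∑ j ∈ U.1, A i j)
    (S : Matrix (Fin n) (Fin n) ℝ) (hS : S.PosDef)
    (St : Matrix (Fin n) (Fin n) ℝ)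
    (hSt : St = ((Nat.factorial n : ℝ))⁻¹ •
      ∑ σ : Equiv.Perm (Fin n), σ.permMatrix ℝ * S * (σ.permMatrix ℝ)ᵀ) :
    St.PosDef ∧ MSE St ≤ MSE S := by
  simp only [permMatrix_mul_mul_transpose] at hSt
  subst hSt
  refine ⟨posDef_inv_factorial_smul_sum_submatrix_perm hS, ?_⟩
  have : Nonempty {U : Finset (Fin n) // t ≤ U.card} := ⟨⟨Finset.univ, by simpa using htn⟩⟩
  rw [hMSE]
  refine ciSup_le fun U => ?_
  have bound (σ : Equiv.Perm (Fin n)) :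
      (d : ℝ) / (U.1.card : ℝ) ^ 2 * ∑ i ∈ U.1, ∑ j ∈ U.1, S.submatrix σ σ i j ≤ MSE S := by
    rw [hMSE, sum_submatrix_perm, ← Finset.card_map (s := U.1) σ.toEmbedding]
    exact le_ciSup (f := fun V : {V : Finset (Fin n) // t ≤ V.card} =>
      (d : ℝ) / (V.1.card : ℝ) ^ 2 * ∑ i ∈ V.1, ∑ j ∈ V.1, S i j)
      (Set.finite_range _).bddAbove ⟨U.1.map σ.toEmbedding, by simpa using U.2⟩
  calc
    (d : ℝ) / (U.1.card : ℝ) ^ 2 * ∑ i ∈ U.1, ∑ j ∈ U.1,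
        ((n.factorial : ℝ)⁻¹ • ∑ σ : Equiv.Perm (Fin n), S.submatrix σ σ) i j
      = (n.factorial : ℝ)⁻¹ * ∑ σ : Equiv.Perm (Fin n),
          (d : ℝ) / (U.1.card : ℝ) ^ 2 * ∑ i ∈ U.1, ∑ j ∈ U.1, S.submatrix σ σ i j := by
        simp only [Matrix.smul_apply, Matrix.sum_apply, smul_eq_mul, ← Finset.mul_sum]
        rw [mul_left_comm]
        simp_rw [Finset.sum_comm (s := U.1) (t := Finset.univ)]
    _ ≤ (n.factorial : ℝ)⁻¹ * ∑ _σ : Equiv.Perm (Fin n), MSE S := by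
        gcongr with σ
        exact bound σ
    _ = MSE S := by
        have : (n.factorial : ℝ) ≠ 0 := by positivity
        simp [Fintype.card_perm, this]
end

section
/- Let A and B be n×n real symmetric positive definite matrices and let θ ∈ [0,1]. Then θ·A + (1−θ)·B is positive definite, and for every x ∈ ℝⁿ, xᵀ·(θ·A + (1−θ)·B)⁻¹·x ≤ θ·(xᵀ·A⁻¹·x) + (1−θ)·(xᵀ·B⁻¹·x). -/
open Matrix

/-- Fenchel–Young inequality for the quadratic form of a positive definite matrix. -/
theorem Matrix.PosDef.two_mul_dotProduct_sub_le {ι : Type*} [Fintype ι] [DecidableEq ι]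
    {A : Matrix ι ι ℝ} (hA : A.PosDef) (x y : ι → ℝ) :
    2 * (x ⬝ᵥ y) - y ⬝ᵥ (A *ᵥ y) ≤ x ⬝ᵥ (A⁻¹ *ᵥ x) := by
  have hdet : IsUnit A.det := (Matrix.isUnit_iff_isUnit_det A).mp hA.isUnit
  have hsymm : Aᵀ = A := by simpa using hA.isHermitian.eq
  have hinv : A *ᵥ (A⁻¹ *ᵥ x) = x := by
    rw [mulVec_mulVec, mul_nonsing_inv _ hdet, one_mulVec]
  have hcross : (A⁻¹ *ᵥ x) ⬝ᵥ (A *ᵥ y) = x ⬝ᵥ y := by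
    rw [dotProduct_mulVec, ← mulVec_transpose, hsymm, hinv]
  have hnonneg := hA.posSemidef.dotProduct_mulVec_nonneg (y - A⁻¹ *ᵥ x)
  simp only [star_trivial, mulVec_sub, sub_dotProduct, dotProduct_sub, hinv, hcross] at hnonneg
  rw [dotProduct_comm y x, dotProduct_comm (A⁻¹ *ᵥ x) x] at hnonneg
  linarith

/-- convexity of the quadratic form of the matrix inverse on positive
definite matrices. -/
theorem stmt_19 (n : ℕ) (A B : Matrix (Fin n) (Fin n) ℝ)
    (hA : A.PosDef) (hB : B.PosDef) (θ : ℝ) (hθ0 : 0 ≤ θ) (hθ1 : θ ≤ 1) :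
    (θ • A + (1 - θ) • B).PosDef ∧
    ∀ x : Fin n → ℝ,
      x ⬝ᵥ ((θ • A + (1 - θ) • B)⁻¹ *ᵥ x) ≤
        θ * (x ⬝ᵥ (A⁻¹ *ᵥ x)) + (1 - θ) * (x ⬝ᵥ (B⁻¹ *ᵥ x)) := by
  have hC : (θ • A + (1 - θ) • B).PosDef := by
    rcases hθ0.eq_or_lt with rfl | hpos
    · simpa using hB
    · exact (hA.smul hpos).add_posSemidef (hB.posSemidef.smul (sub_nonneg.mpr hθ1))
  refine ⟨hC, fun x => ?_⟩
  have hdet := (Matrix.isUnit_iff_isUnit_det _).mp hC.isUnit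
  set y := (θ • A + (1 - θ) • B)⁻¹ *ᵥ x with hy
  have hCy : θ * (y ⬝ᵥ (A *ᵥ y)) + (1 - θ) * (y ⬝ᵥ (B *ᵥ y)) = x ⬝ᵥ y := by
    have hinv : (θ • A + (1 - θ) • B) *ᵥ y = x := by
      rw [hy, mulVec_mulVec, mul_nonsing_inv _ hdet, one_mulVec]
    rw [dotProduct_comm x y, ← hinv]
    simp only [add_mulVec, smul_mulVec, dotProduct_add, dotProduct_smul, smul_eq_mul]
  have h₁ := mul_le_mul_of_nonneg_left (hA.two_mul_dotProduct_sub_le x y) hθ0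
  have h₂ := mul_le_mul_of_nonneg_left (hB.two_mul_dotProduct_sub_le x y) (sub_nonneg.mpr hθ1)
  linarith
end
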